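/- Let (ρ_i,η_i) ∈ ℋ(V_i), i = 1,2, set V = V_1 ⊕ V_2, ρ = ρ_1 ⊕ ρ_2, η = η_1 ⊕ η_2, and let η̃ ∈ 𝓔(V_1(ρ_1,η_1), V_2(ρ_2,η_2)). Then, with ι_0(v_2) = (0,v_2) and π_0((v_1,v_2)) = v_1, the sequence 0 → V_2(ρ_2,η_2) →^{ι_0} V(ρ, η+η̃) →^{π_0} V_1(ρ_1,η_1) → 0 is a short exact sequence of 𝔞[t]-modules. -/

import Mathlib

open TensorAlgebra TensorProduct Polynomial

noncomputable section

/-- The graded pieces `F^r(a)` of the free Lie algebra on the vector space `a`,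
realized inside the tensor algebra `T(a)`:  `F¹(a) = ι(a)` and `F^{r+1}(a)` is spanned by
the commutators `ι(x) * y - y * ι(x)` with `x ∈ a`, `y ∈ F^r(a)`. -/
def Fr (a : Type*) [LieRing a] [LieAlgebra ℂ a] : ℕ → Submodule ℂ (TensorAlgebra ℂ a)
  | 0 => ⊥
  | 1 => LinearMap.range (TensorAlgebra.ι ℂ (M := a))
  | (r + 2) => Submodule.span ℂ
      {u | ∃ (x : a) (y : TensorAlgebra ℂ a), y ∈ Fr a (r + 1) ∧
        u = TensorAlgebra.ι ℂ x * y - y * TensorAlgebra.ι ℂ x}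

/-- The free Lie algebra `F(a) = ⊕_{r>0} F^r(a)` on the vector space `a`,
as a subspace of the tensor algebra. -/
def FLie (a : Type*) [LieRing a] [LieAlgebra ℂ a] : Submodule ℂ (TensorAlgebra ℂ a) :=
  ⨆ r, Fr a r

/-- `IsTau a τ` says that the linear map `τ` is (a linear extension to `T(a)` of) the canonical
Lie algebra homomorphism `τ : F(a) → a`: it is the identity on `F¹(a) = a` and takes the
commutator bracket of `T(a)` (restricted to `F(a)`) to the bracket of `a`. -/
def IsTau (a : Type*) [LieRing a] [LieAlgebra ℂ a] (τ : TensorAlgebra ℂ a →ₗ[ℂ] a) : Prop :=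
  (∀ x : a, τ (TensorAlgebra.ι ℂ x) = x) ∧
  ∀ r s : ℕ, ∀ u ∈ Fr a r, ∀ v ∈ Fr a s, τ (u * v - v * u) = ⁅τ u, τ v⁆

/-- The current algebra `a[t] = a ⊗ ℂ[t]`, with bracket `⁅x ⊗ f, y ⊗ g⁆ = ⁅x, y⁆ ⊗ fg`. -/
abbrev Cur (a : Type*) [LieRing a] [LieAlgebra ℂ a] : Type _ := Polynomial ℂ ⊗[ℂ] a

/-- `IsTauT a τ τt` says that the linear map `τt` is (a linear extension to `T(a)` of) the map
`τ[t] : F(a) → a[t]` given by `τ[t](𝐱) = τ(𝐱) ⊗ t^r` for `𝐱 ∈ F^r(a)`. -/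
def IsTauT (a : Type*) [LieRing a] [LieAlgebra ℂ a] (τ : TensorAlgebra ℂ a →ₗ[ℂ] a)
    (τt : TensorAlgebra ℂ a →ₗ[ℂ] Cur a) : Prop :=
  ∀ r : ℕ, ∀ u ∈ Fr a r, τt u = ((X : ℂ[X]) ^ r) ⊗ₜ[ℂ] (τ u)

end

noncomputable section

/-- `MemH a V τ ρ η`, i.e. `(ρ, η) ∈ ℋ(V)`:  `ρ` is a Lie algebra homomorphism (C1), `η` is a
homomorphism of `a`-modules for the `a`-module structure on `End V` induced by `ρ` (C2), and
`ker τ_r ⊆ ker η^{⊙r}` for all `r > 0` (C3), where `η^{⊙r}` is the restriction to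
`F^r(a) ⊆ T^r(a)` of the algebra homomorphism `η_T : T(a) → End V` extending `η`. -/
def MemH (a : Type*) [LieRing a] [LieAlgebra ℂ a] {V : Type*} [AddCommGroup V] [Module ℂ V]
    (τ : TensorAlgebra ℂ a →ₗ[ℂ] a) (ρ η : a →ₗ[ℂ] Module.End ℂ V) : Prop :=
  (∀ x y : a, ρ ⁅x, y⁆ = ⁅ρ x, ρ y⁆) ∧
  (∀ x y : a, η ⁅x, y⁆ = ⁅ρ x, η y⁆) ∧
  (∀ r : ℕ, ∀ u ∈ Fr a r, τ u = 0 → TensorAlgebra.lift ℂ η u = 0)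

/-- `IsCurHom a ρ₁ η₁ ρ₂ η₂ φ` says that the linear map `φ : V₁ → V₂` is a homomorphism of
`a[t]`-modules from `V₁(ρ₁, η₁)` to `V₂(ρ₂, η₂)`: it intertwines the actions of `x ⊗ 1`
(given by `ρᵢ`) and of `x ⊗ t^r` (given by `ηᵢ^{⊙r}(𝐱)` for `𝐱 ∈ F^r(a)` with `τ_r(𝐱) = x`). -/
def IsCurHom (a : Type*) [LieRing a] [LieAlgebra ℂ a]
    {V1 V2 : Type*} [AddCommGroup V1] [Module ℂ V1] [AddCommGroup V2] [Module ℂ V2]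
    (ρ1 η1 : a →ₗ[ℂ] Module.End ℂ V1) (ρ2 η2 : a →ₗ[ℂ] Module.End ℂ V2)
    (φ : V1 →ₗ[ℂ] V2) : Prop :=
  (∀ x : a, φ ∘ₗ ρ1 x = ρ2 x ∘ₗ φ) ∧
  ∀ r : ℕ, ∀ u ∈ Fr a r,
    φ ∘ₗ (TensorAlgebra.lift ℂ η1 u : Module.End ℂ V1)
      = (TensorAlgebra.lift ℂ η2 u : Module.End ℂ V2) ∘ₗ φ

end

noncomputable section

variable (a : Type*) [LieRing a] [LieAlgebra ℂ a]
variable (V1 V2 : Type*) [AddCommGroup V1] [Module ℂ V1] [AddCommGroup V2] [Module ℂ V2]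

/-- The space `Hom_a(V₁, V₂)` of `a`-module homomorphisms, as a subspace of `Hom(V₁,V₂)`. -/
def homA (ρ1 : a →ₗ[ℂ] Module.End ℂ V1) (ρ2 : a →ₗ[ℂ] Module.End ℂ V2) :
    Submodule ℂ (V1 →ₗ[ℂ] V2) where
  carrier := {ψ | ∀ x : a, ψ ∘ₗ ρ1 x = ρ2 x ∘ₗ ψ}
  add_mem' := by
    intro f g hf hg x
    ext v
    simp only [LinearMap.add_comp, LinearMap.comp_add, hf x, hg x]
  zero_mem' := by
    intro x
    ext v
    simp
  smul_mem' := by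
    intro c f hf x
    ext v
    simp only [LinearMap.smul_comp, LinearMap.comp_smul, hf x]

/-- The space `Hom_{a[t]}(V₁(ρ₁,η₁), V₂(ρ₂,η₂))` of `a[t]`-module homomorphisms. -/
def homAt (ρ1 η1 : a →ₗ[ℂ] Module.End ℂ V1) (ρ2 η2 : a →ₗ[ℂ] Module.End ℂ V2) :
    Submodule ℂ (V1 →ₗ[ℂ] V2) where
  carrier := {ψ | IsCurHom a ρ1 η1 ρ2 η2 ψ}
  add_mem' := by
    intro f g hf hg
    refine ⟨fun x => ?_, fun r u hu => ?_⟩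
    · ext v; simp only [LinearMap.add_comp, LinearMap.comp_add, hf.1 x, hg.1 x]
    · ext v; simp only [LinearMap.add_comp, LinearMap.comp_add, hf.2 r u hu, hg.2 r u hu]
  zero_mem' := by
    refine ⟨fun x => ?_, fun r u hu => ?_⟩ <;> (ext v; simp)
  smul_mem' := by
    intro c f hf
    refine ⟨fun x => ?_, fun r u hu => ?_⟩
    · ext v; simp only [LinearMap.smul_comp, LinearMap.comp_smul, hf.1 x]
    · ext v; simp only [LinearMap.smul_comp, LinearMap.comp_smul, hf.2 r u hu]

/-- The space `Hom_a(a, Hom(V₁,V₂))` of `a`-module homomorphisms from the adjoint module to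
`Hom(V₁,V₂)` (the latter an `a`-module via `ρ₁`, `ρ₂`). -/
def homAa (ρ1 : a →ₗ[ℂ] Module.End ℂ V1) (ρ2 : a →ₗ[ℂ] Module.End ℂ V2) :
    Submodule ℂ (a →ₗ[ℂ] (V1 →ₗ[ℂ] V2)) where
  carrier := {θ | ∀ x y : a, θ ⁅x, y⁆ = ρ2 x ∘ₗ θ y - θ y ∘ₗ ρ1 x}
  add_mem' := by
    intro f g hf hg x y
    ext v
    simp only [map_add, LinearMap.add_apply, LinearMap.comp_add, LinearMap.add_comp, hf x y,
      hg x y, LinearMap.sub_apply]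
    abel
  zero_mem' := by intro x y; simp
  smul_mem' := by
    intro c f hf x y
    ext v
    simp only [map_smul, LinearMap.smul_apply, LinearMap.comp_smul, LinearMap.smul_comp,
      hf x y, LinearMap.sub_apply, smul_sub]

/-- The linear map `ψ ↦ η̃_ψ = (x ↦ η₂(x) ∘ ψ - ψ ∘ η₁(x))`. -/
def etaTildeMap (η1 : a →ₗ[ℂ] Module.End ℂ V1) (η2 : a →ₗ[ℂ] Module.End ℂ V2) :
    (V1 →ₗ[ℂ] V2) →ₗ[ℂ] (a →ₗ[ℂ] (V1 →ₗ[ℂ] V2)) where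
  toFun ψ :=
    { toFun := fun x => η2 x ∘ₗ ψ - ψ ∘ₗ η1 x
      map_add' := by
        intro x y
        simp only [map_add, LinearMap.add_comp, LinearMap.comp_add]
        abel
      map_smul' := by
        intro c x
        simp only [map_smul, LinearMap.smul_comp, LinearMap.comp_smul, RingHom.id_apply,
          smul_sub] }
  map_add' := by
    intro f g
    ext x v
    simp only [LinearMap.coe_mk, AddHom.coe_mk, LinearMap.add_apply, LinearMap.comp_add,
      LinearMap.add_comp, LinearMap.sub_apply]
    abel
  map_smul' := by
    intro c f
    ext x v
    simp only [LinearMap.coe_mk, AddHom.coe_mk, LinearMap.smul_apply, LinearMap.comp_smul,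
      LinearMap.smul_comp, RingHom.id_apply, LinearMap.sub_apply, smul_sub]

end

noncomputable section

variable (a : Type*) [LieRing a] [LieAlgebra ℂ a]
variable (V1 V2 : Type*) [AddCommGroup V1] [Module ℂ V1] [AddCommGroup V2] [Module ℂ V2]

/-- The direct sum `ρ₁ ⊕ ρ₂ : a → End(V₁ × V₂)` of two families of operators. -/
def prodL (ρ1 : a →ₗ[ℂ] Module.End ℂ V1) (ρ2 : a →ₗ[ℂ] Module.End ℂ V2) :
    a →ₗ[ℂ] Module.End ℂ (V1 × V2) where
  toFun x := (ρ1 x).prodMap (ρ2 x)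
  map_add' x y := by ext v <;> simp
  map_smul' c x := by ext v <;> simp

/-- A linear map `θ̃ : a → Hom(V₁,V₂)` regarded as a map `a → End(V₁ × V₂)` in the obvious
(strictly lower triangular) way. -/
def offDiag (θ : a →ₗ[ℂ] (V1 →ₗ[ℂ] V2)) : a →ₗ[ℂ] Module.End ℂ (V1 × V2) where
  toFun x := (LinearMap.inr ℂ V1 V2) ∘ₗ (θ x) ∘ₗ (LinearMap.fst ℂ V1 V2)
  map_add' x y := by ext v <;> simp
  map_smul' c x := by ext v <;> simp

/-- The subspace `𝓔(V₁(ρ₁,η₁), V₂(ρ₂,η₂))` of maps `η̃ : a → Hom(V₁,V₂)` such that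
`(ρ₁⊕ρ₂, (η₁⊕η₂) + η̃) ∈ ℋ(V₁ × V₂)`. -/
def MemE (τ : TensorAlgebra ℂ a →ₗ[ℂ] a)
    (ρ1 η1 : a →ₗ[ℂ] Module.End ℂ V1) (ρ2 η2 : a →ₗ[ℂ] Module.End ℂ V2)
    (θ : a →ₗ[ℂ] (V1 →ₗ[ℂ] V2)) : Prop :=
  MemH a τ (prodL a V1 V2 ρ1 ρ2) (prodL a V1 V2 η1 η2 + offDiag a V1 V2 θ)

end

/-- A linear map intertwining two families of operators indexed by `M` intertwines the
induced actions of the tensor algebra of `M`. -/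
theorem comp_tensorAlgebra_lift {R M V W : Type*} [CommSemiring R] [AddCommMonoid M] [Module R M]
    [AddCommMonoid V] [Module R V] [AddCommMonoid W] [Module R W]
    {f : M →ₗ[R] Module.End R V} {g : M →ₗ[R] Module.End R W} {φ : V →ₗ[R] W}
    (h : ∀ x, φ ∘ₗ f x = g x ∘ₗ φ) (u : TensorAlgebra R M) :
    φ ∘ₗ (TensorAlgebra.lift R f u : Module.End R V) =
      (TensorAlgebra.lift R g u : Module.End R W) ∘ₗ φ := by
  induction u using TensorAlgebra.induction with
  | algebraMap r => ext v; simp [Module.algebraMap_end_apply]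
  | ι x => simpa using h x
  | mul u v hu hv =>
    rw [map_mul, map_mul, Module.End.mul_eq_comp, Module.End.mul_eq_comp, ← LinearMap.comp_assoc,
      hu, LinearMap.comp_assoc, hv, LinearMap.comp_assoc]
  | add u v hu hv => rw [map_add, map_add, LinearMap.comp_add, LinearMap.add_comp, hu, hv]

/-- Let `(ρᵢ,ηᵢ) ∈ ℋ(Vᵢ)`, `V = V₁ ⊕ V₂`, `ρ = ρ₁⊕ρ₂`, `η = η₁⊕η₂`, and let
`η̃ ∈ 𝓔(V₁(ρ₁,η₁), V₂(ρ₂,η₂))`.  Then, with `ι₀(v₂) = (0,v₂)` and `π₀((v₁,v₂)) = v₁`,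
`0 → V₂(ρ₂,η₂) → V(ρ, η+η̃) → V₁(ρ₁,η₁) → 0` is a short exact sequence of `a[t]`-modules. -/
theorem statement12 (a : Type*) [LieRing a] [LieAlgebra ℂ a]
    (h𝔞 : Submodule.span ℂ {z : a | ∃ x y : a, z = ⁅x, y⁆} = ⊤)
    (τ : TensorAlgebra ℂ a →ₗ[ℂ] a) (hτ : IsTau a τ)
    (V1 V2 : Type*) [AddCommGroup V1] [Module ℂ V1] [AddCommGroup V2] [Module ℂ V2]
    (ρ1 η1 : a →ₗ[ℂ] Module.End ℂ V1) (ρ2 η2 : a →ₗ[ℂ] Module.End ℂ V2)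
    (h1 : MemH a τ ρ1 η1) (h2 : MemH a τ ρ2 η2)
    (θ : a →ₗ[ℂ] (V1 →ₗ[ℂ] V2)) (hθ : MemE a V1 V2 τ ρ1 η1 ρ2 η2 θ) :
    IsCurHom a ρ2 η2 (prodL a V1 V2 ρ1 ρ2) (prodL a V1 V2 η1 η2 + offDiag a V1 V2 θ)
      (LinearMap.inr ℂ V1 V2) ∧
    IsCurHom a (prodL a V1 V2 ρ1 ρ2) (prodL a V1 V2 η1 η2 + offDiag a V1 V2 θ) ρ1 η1
      (LinearMap.fst ℂ V1 V2) ∧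
    Function.Injective (LinearMap.inr ℂ V1 V2) ∧
    Function.Surjective (LinearMap.fst ℂ V1 V2) ∧
    LinearMap.range (LinearMap.inr ℂ V1 V2) = LinearMap.ker (LinearMap.fst ℂ V1 V2) := by
  refine ⟨⟨fun x => ?_, fun _ u _ => comp_tensorAlgebra_lift (fun x => ?_) u⟩,
    ⟨fun x => ?_, fun _ u _ => comp_tensorAlgebra_lift (fun x => ?_) u⟩,
    LinearMap.inr_injective, LinearMap.fst_surjective, LinearMap.range_inr ℂ V1 V2⟩
  all_goals
    ext v <;> simp [prodL, offDiag]
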